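/- arXiv:2503.07208 — 11 statements merged into one kernel-verified Lean document; each statement's English description precedes it below -/
import Mathlib

section
/- Let T be a tournament, S ⊆ V(T), and s ∈ S. Then there exists a directed cycle of T containing s if and only if there exists a directed cycle of T on exactly three vertices containing s. -/
/-- A tournament on vertex type `V`, given by its arc set `A ⊆ V × V`:
no self-loops, and between any two distinct vertices exactly one arc. -/
def IsTournament {V : Type*} (A : Set (V × V)) : Prop :=
  (∀ v : V, (v, v) ∉ A) ∧ ∀ u v : V, u ≠ v → ((u, v) ∈ A ↔ (v, u) ∉ A)

/-- `f : ZMod n → V` describes a directed cycle (on exactly `n` distinct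
vertices) in the digraph with arc set `A`. -/
def IsCycle {V : Type*} (A : Set (V × V)) (n : ℕ) (f : ZMod n → V) : Prop :=
  2 ≤ n ∧ Function.Injective f ∧ ∀ i : ZMod n, (f i, f (i + 1)) ∈ A

/-- In a tournament, a walk that returns to its start `g 0` yields a directed triangle through `g 0`. -/
theorem IsTournament.exists_triangle_of_closed_walk {V : Type*} {A : Set (V × V)}
    (hT : IsTournament A) {g : ℕ → V} (hg : ∀ k, (g k, g (k + 1)) ∈ A) {n : ℕ} (hn : 0 < n)
    (hclosed : g n = g 0) :
    ∃ a b, (g 0, a) ∈ A ∧ (a, b) ∈ A ∧ (b, g 0) ∈ A := by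
  by_contra! h
  have hout : ∀ k, (g 0, g (k + 1)) ∈ A := by
    intro k
    induction k with
    | zero => exact hg 0
    | succ k ih =>
      have hne : g 0 ≠ g (k + 1) := fun e => hT.1 (g 0) (by rw [← e] at ih; exact ih)
      have hne' : g 0 ≠ g (k + 2) := by
        intro e
        have hback := hg (k + 1)
        rw [← e] at hback
        exact (hT.2 _ _ hne).1 ih hback
      exact (hT.2 _ _ hne').2 (h _ _ ih (hg (k + 1)))
  obtain ⟨m, rfl⟩ := Nat.exists_eq_succ_of_ne_zero hn.ne'
  have hloop := hout m
  rw [hclosed] at hloop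
  exact hT.1 _ hloop

/-- A directed triangle in a loopless digraph is a cycle on three vertices. -/
theorem isCycle_three {V : Type*} {A : Set (V × V)} (hloop : ∀ v, (v, v) ∉ A) {s a b : V}
    (hsa : (s, a) ∈ A) (hab : (a, b) ∈ A) (hbs : (b, s) ∈ A) :
    IsCycle A 3 (![s, a, b] : Fin 3 → V) := by
  have h₁ : s ≠ a := by rintro rfl; exact hloop _ hsa
  have h₂ : a ≠ b := by rintro rfl; exact hloop _ hab
  have h₃ : b ≠ s := by rintro rfl; exact hloop _ hbs
  refine ⟨by norm_num, ?_, ?_⟩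
  · change Function.Injective (![s, a, b] : Fin 3 → V)
    intro i j hij
    fin_cases i <;> fin_cases j <;> simp_all
  · change ∀ i : Fin 3, ((![s, a, b] : Fin 3 → V) i, (![s, a, b] : Fin 3 → V) (i + 1)) ∈ A
    intro i
    fin_cases i
    exacts [hsa, hab, hbs]

/-- In a tournament `T`, for `s ∈ S`, there is a directed cycle
containing `s` iff there is a directed cycle on exactly three vertices
containing `s`. -/
theorem stmt_0 {V : Type*} [Fintype V] (A : Set (V × V)) (hT : IsTournament A)
    (S : Set V) (s : V) (hs : s ∈ S) :
    (∃ (n : ℕ) (f : ZMod n → V), IsCycle A n f ∧ ∃ i, f i = s) ↔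
      (∃ f : ZMod 3 → V, IsCycle A 3 f ∧ ∃ i, f i = s) := by
  constructor
  · rintro ⟨n, f, ⟨hn, -, hf⟩, i, rfl⟩
    have hg : ∀ k : ℕ, (f (i + k), f (i + (k + 1 : ℕ))) ∈ A := fun k => by
      simpa [add_assoc] using hf (i + k)
    obtain ⟨a, b, hsa, hab, hbs⟩ :=
      hT.exists_triangle_of_closed_walk (g := fun k : ℕ => f (i + k)) hg
        (by omega : 0 < n) (by simp)
    simp only [Nat.cast_zero, add_zero] at hsa hbs
    exact ⟨_, isCycle_three hT.1 hsa hab hbs, (0 : Fin 3), rfl⟩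
  · rintro ⟨f, hf⟩
    exact ⟨3, f, hf⟩
end

section
/- Let T be a tournament, S ⊆ V(T), and F ⊆ A(T). Then F is inclusion-wise minimal among arc sets whose deletion makes T S-acyclic (i.e., T − F is S-acyclic but T − F' is not S-acyclic for every proper subset F' ⊊ F) if and only if F is inclusion-wise minimal among arc sets whose reversal makes T S-acyclic (i.e., T ⊛ F is S-acyclic but T ⊛ F' is not S-acyclic for every proper subset F' ⊊ F). -/
/-- The digraph with arc set `A` has a directed cycle containing a vertex of `S`. -/
def HasSCycle {V : Type*} (A : Set (V × V)) (S : Set V) : Prop :=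
  ∃ (n : ℕ) (f : ZMod n → V), IsCycle A n f ∧ ∃ i, f i ∈ S

/-- The digraph with arc set `A` is `S`-acyclic: it has no `S`-cycle. -/
def SAcyclic {V : Type*} (A : Set (V × V)) (S : Set V) : Prop :=
  ¬ HasSCycle A S

/-- The arc set obtained from `A` by reversing all arcs of `F`:
`(A ∪ rev F) \ F` where `rev F = {(u,v) : (v,u) ∈ F}`. -/
def revArcs {V : Type*} (A F : Set (V × V)) : Set (V × V) :=
  (A ∪ {p | (p.2, p.1) ∈ F}) \ F

theorem IsCycle.transGen_self {V : Type*} {A : Set (V × V)} {n : ℕ} {f : ZMod n → V}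
    (hf : IsCycle A n f) (i : ZMod n) :
    Relation.TransGen (fun x y => (x, y) ∈ A) (f i) (f i) := by
  obtain ⟨hn, -, hA⟩ := hf
  have walk : ∀ k : ℕ,
      Relation.TransGen (fun x y => (x, y) ∈ A) (f i) (f (i + ((k + 1 : ℕ) : ZMod n))) := by
    intro k
    induction k with
    | zero => simpa using Relation.TransGen.single (hA i)
    | succ k ih =>
      have h := ih.tail (hA _)
      convert h using 2
      push_cast
      ring
  have h := walk (n - 1)
  rwa [Nat.sub_add_cancel (by omega), ZMod.natCast_self, add_zero] at h

/-- The complement of an arc in a cycle is a path from its head to its tail. -/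
theorem IsCycle.reflTransGen_of_ne {V : Type*} {A D : Set (V × V)} {n : ℕ} {f : ZMod n → V}
    (hf : IsCycle A n f) (i : ZMod n)
    (hD : ∀ p ∈ A, p ≠ (f i, f (i + 1)) → p ∈ D) :
    Relation.ReflTransGen (fun x y => (x, y) ∈ D) (f (i + 1)) (f i) := by
  obtain ⟨hn, hinj, hA⟩ := hf
  have walk : ∀ k : ℕ, k < n →
      Relation.ReflTransGen (fun x y => (x, y) ∈ D) (f (i + 1)) (f (i + 1 + (k : ZMod n))) := by
    intro k
    induction k with
    | zero => intro _; simpa using Relation.ReflTransGen.refl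
    | succ k ih =>
      intro hk
      have hne : ((k + 1 : ℕ) : ZMod n) ≠ 0 := by
        rw [Ne, ZMod.natCast_eq_zero_iff]
        exact fun h => absurd (Nat.le_of_dvd (by omega) h) (by omega)
      have harc := hD _ (hA (i + 1 + (k : ZMod n))) (by
        intro h
        have h' := hinj (Prod.ext_iff.mp h).1
        apply hne
        push_cast
        linear_combination h')
      convert (ih (by omega)).tail harc using 2
      push_cast
      ring
  have h := walk (n - 1) (by omega)
  rwa [Nat.cast_sub (by omega), ZMod.natCast_self, Nat.cast_one,
    show i + 1 + (0 - 1) = i by ring] at h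

theorem exists_walk_of_transGen {V : Type*} {r : V → V → Prop} {a b : V}
    (h : Relation.TransGen r a b) :
    ∃ (n : ℕ) (g : ℕ → V), 0 < n ∧ g 0 = a ∧ g n = b ∧ ∀ i < n, r (g i) (g (i + 1)) := by
  induction h with
  | @single b hab =>
    refine ⟨1, fun k => if k = 0 then a else b, one_pos, by simp, by simp, ?_⟩
    intro i hi
    obtain rfl : i = 0 := by omega
    simpa using hab
  | @tail b c _ hbc ih =>
    obtain ⟨n, g, hn, h0, hgn, hg⟩ := ih
    refine ⟨n + 1, fun k => if k ≤ n then g k else c, by omega, by simpa using h0, by simp, ?_⟩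
    intro i hi
    rcases Nat.lt_or_ge i n with h | h
    · simpa [h.le, Nat.succ_le_of_lt h] using hg i h
    · obtain rfl : i = n := by omega
      simpa [hgn] using hbc

/-- A closed walk in a loopless digraph contains a cycle through its base point. -/
theorem exists_isCycle_of_transGen_self {V : Type*} {A : Set (V × V)}
    (hA : ∀ v, (v, v) ∉ A) {s : V} (h : Relation.TransGen (fun x y => (x, y) ∈ A) s s) :
    ∃ (n : ℕ) (f : ZMod n → V), IsCycle A n f ∧ ∃ i, f i = s := by
  classical
  have hex : ∃ n : ℕ, ∃ g : ℕ → V,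
      0 < n ∧ g 0 = s ∧ g n = s ∧ ∀ i < n, (g i, g (i + 1)) ∈ A :=
    exists_walk_of_transGen h
  obtain ⟨g, hn, h0, hgn, hg⟩ := Nat.find_spec hex
  have hmin := fun m => Nat.find_min (m := m) hex
  generalize Nat.find hex = n at *
  have hinj : ∀ i j, i < j → j < n → g i ≠ g j := by
    intro i j hij hj heq
    refine hmin (n - (j - i)) (by omega)
      ⟨fun k => if k ≤ i then g k else g (k + (j - i)), by omega, by simpa using h0, ?_, ?_⟩
    · simp only
      rw [if_neg (by omega), Nat.sub_add_cancel (by omega), hgn]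
    · intro k hk
      rcases lt_trichotomy k i with h | h | h
      · simpa [h.le, Nat.succ_le_of_lt h] using hg k (by omega)
      · subst h
        have := hg j hj
        simpa [heq, show k + 1 + (j - k) = j + 1 by omega] using this
      · have := hg (k + (j - i)) (by omega)
        simpa [show ¬ k ≤ i by omega, show ¬ k + 1 ≤ i by omega,
          show k + 1 + (j - i) = k + (j - i) + 1 by omega] using this
  have hn2 : 2 ≤ n := by
    by_contra hlt
    obtain rfl : n = 1 := by omega
    have := hg 0 one_pos
    rw [h0, zero_add, hgn] at this
    exact hA s this
  have : NeZero n := ⟨by omega⟩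
  have : Fact (1 < n) := ⟨hn2⟩
  refine ⟨n, fun i => g i.val, ⟨hn2, ?_, ?_⟩, 0, by simpa using h0⟩
  · intro i j hij
    apply ZMod.val_injective n
    rcases lt_trichotomy i.val j.val with h | h | h
    · exact absurd hij (hinj _ _ h j.val_lt)
    · exact h
    · exact absurd hij.symm (hinj _ _ h i.val_lt)
  · intro i
    have hstep := hg i.val i.val_lt
    have hval : g (i + 1).val = g (i.val + 1) := by
      rw [ZMod.val_add, ZMod.val_one]
      rcases Nat.lt_or_ge (i.val + 1) n with h | h
      · rw [Nat.mod_eq_of_lt h]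
      · have : i.val + 1 = n := by have := i.val_lt; omega
        rw [this, Nat.mod_self, h0, hgn]
    simpa only [hval] using hstep

theorem SAcyclic.mono {V : Type*} {A B : Set (V × V)} {S : Set V} (hAB : A ⊆ B)
    (hB : SAcyclic B S) : SAcyclic A S := by
  rintro ⟨n, f, ⟨hn, hinj, hA⟩, hS⟩
  exact hB ⟨n, f, ⟨hn, hinj, fun i => hAB (hA i)⟩, hS⟩

theorem diff_subset_revArcs {V : Type*} (A F : Set (V × V)) : A \ F ⊆ revArcs A F :=
  Set.sdiff_subset_sdiff_left Set.subset_union_left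

/-- Reversing a minimal deletion set destroys all `S`-cycles: each reversed arc can be replaced
by a path avoiding the deletion set. -/
theorem sAcyclic_revArcs_of_minimal {V : Type*} {A F : Set (V × V)} {S : Set V}
    (hA : ∀ v, (v, v) ∉ A) (hF : F ⊆ A) (hac : SAcyclic (A \ F) S)
    (hmin : ∀ F' : Set (V × V), F' ⊂ F → ¬ SAcyclic (A \ F') S) :
    SAcyclic (revArcs A F) S := by
  have bypass : ∀ u v, (u, v) ∈ F →
      Relation.TransGen (fun x y => (x, y) ∈ A \ F) v u := by
    intro u v huv
    obtain ⟨n, f, hf, hS⟩ := not_not.mp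
      (hmin (F \ {(u, v)}) (Set.sdiff_singleton_ssubset.mpr huv))
    obtain ⟨i, hi⟩ : ∃ i, (f i, f (i + 1)) ∉ A \ F := by
      by_contra! h
      exact hac ⟨n, f, ⟨hf.1, hf.2.1, h⟩, hS⟩
    have hi' : (f i, f (i + 1)) = (u, v) := by
      have := hf.2.2 i
      simp only [Set.mem_sdiff, Set.mem_singleton_iff] at this hi
      tauto
    have hpath := hf.reflTransGen_of_ne (D := A \ F) i (by
      rw [hi']
      intro p hp hne
      exact ⟨hp.1, fun hpF => hp.2 ⟨hpF, hne⟩⟩)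
    obtain ⟨rfl, rfl⟩ := Prod.ext_iff.mp hi'
    rcases Relation.reflTransGen_iff_eq_or_transGen.mp hpath with h | h
    · have := hF huv
      simp only [h] at this
      exact absurd this (hA _)
    · exact h
  rintro ⟨n, f, hf, i, hi⟩
  have hclosed : Relation.TransGen (fun x y => (x, y) ∈ A \ F) (f i) (f i) := by
    refine Relation.TransGen.trans_induction_on (hf.transGen_self i)
      (motive := fun {a b} _ => Relation.TransGen (fun x y => (x, y) ∈ A \ F) a b)
      ?_ (fun _ _ => Relation.TransGen.trans)
    rintro a b ⟨hab | hab, hnF⟩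
    · exact .single ⟨hab, hnF⟩
    · exact bypass b a hab
  obtain ⟨m, g, hg, j, hj⟩ := exists_isCycle_of_transGen_self (fun v hv => hA v hv.1) hclosed
  exact hac ⟨m, g, hg, j, hj ▸ hi⟩

/-- `F ⊆ A(T)` is inclusion-wise minimal among arc sets whose
deletion makes `T` `S`-acyclic iff it is inclusion-wise minimal among arc sets
whose reversal makes `T` `S`-acyclic. -/
theorem stmt_2 {V : Type*} [Fintype V] (A : Set (V × V)) (hT : IsTournament A)
    (S : Set V) (F : Set (V × V)) (hF : F ⊆ A) :
    (SAcyclic (A \ F) S ∧ ∀ F' : Set (V × V), F' ⊂ F → ¬ SAcyclic (A \ F') S) ↔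
      (SAcyclic (revArcs A F) S ∧
        ∀ F' : Set (V × V), F' ⊂ F → ¬ SAcyclic (revArcs A F') S) := by
  constructor
  · rintro ⟨hac, hmin⟩
    exact ⟨sAcyclic_revArcs_of_minimal hT.1 hF hac hmin,
      fun F' hF' h => hmin F' hF' (h.mono (diff_subset_revArcs A F'))⟩
  · rintro ⟨hac, hmin⟩
    refine ⟨hac.mono (diff_subset_revArcs A F), fun F' hF' h => ?_⟩
    obtain ⟨G, hGF', hG⟩ :=
      exists_minimal_le_of_wellFoundedLT (fun G : Set (V × V) => SAcyclic (A \ G) S) F' h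
    have hGF : G ⊂ F := lt_of_le_of_lt hGF' hF'
    exact hmin G hGF (sAcyclic_revArcs_of_minimal hT.1 (hGF.subset.trans hF) hG.prop
      fun G' hG' => hG.not_prop_of_lt hG')
end

section
/- Let T be a tournament and S ⊆ V(T). Then T admits an S-topological ordering with respect to S if and only if T contains no S-triangle. -/
/-- The digraph with arc set `A` has an `S`-triangle: a directed cycle on
exactly three vertices containing a vertex of `S`. -/
def HasSTriangle {V : Type*} (A : Set (V × V)) (S : Set V) : Prop :=
  ∃ f : ZMod 3 → V, IsCycle A 3 f ∧ ∃ i, f i ∈ S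

/-- Reachability inside the vertex set `W` using arcs of `A` between vertices
of `W`. -/
def ReachIn {V : Type*} (A : Set (V × V)) (W : Set V) : V → V → Prop :=
  Relation.ReflTransGen (fun x y => x ∈ W ∧ y ∈ W ∧ (x, y) ∈ A)

/-- Every two vertices of `W` are joined by directed paths (in both
directions) inside the subgraph induced on `W`. -/
def StronglyConnectedIn {V : Type*} (A : Set (V × V)) (W : Set V) : Prop :=
  ∀ u ∈ W, ∀ v ∈ W, ReachIn A W u v

/-- `W` is a strongly connected component of the digraph with arc set `A`:
a maximal set of vertices any two of which reach each other within the
induced subgraph. -/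
def IsSCC {V : Type*} (A : Set (V × V)) (W : Set V) : Prop :=
  W.Nonempty ∧ StronglyConnectedIn A W ∧
    ∀ W' : Set V, W ⊆ W' → StronglyConnectedIn A W' → W' = W

/-- Reachability by directed paths in the whole digraph. -/
def Reach {V : Type*} (A : Set (V × V)) : V → V → Prop :=
  Relation.ReflTransGen (fun x y => (x, y) ∈ A)

theorem ReachIn.reach {V : Type*} {A : Set (V × V)} {W : Set V} {u v : V}
    (h : ReachIn A W u v) : Reach A u v :=
  Relation.ReflTransGen.mono (fun _ _ hxy => hxy.2.2) _ _ h

theorem IsTournament.asymm {V : Type*} {A : Set (V × V)} (hT : IsTournament A) {u v : V}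
    (h : (u, v) ∈ A) : (v, u) ∉ A := by
  by_cases huv : u = v
  · subst huv
    exact hT.1 u
  · exact (hT.2 u v huv).1 h

theorem IsTournament.mem_or_mem {V : Type*} {A : Set (V × V)} (hT : IsTournament A) {u v : V}
    (h : u ≠ v) : (u, v) ∈ A ∨ (v, u) ∈ A := by
  have := hT.2 u v h
  tauto

theorem IsTournament.isCycle_triangle {V : Type*} {A : Set (V × V)} (hT : IsTournament A)
    {a b c : V} (hab : (a, b) ∈ A) (hbc : (b, c) ∈ A) (hca : (c, a) ∈ A) :
    IsCycle A 3 (![a, b, c] : Fin 3 → V) := by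
  have ne : ∀ {x y : V}, (x, y) ∈ A → x ≠ y := by
    rintro x _ h rfl
    exact hT.1 x h
  have h₁ := ne hab
  have h₂ := ne hbc
  have h₃ := ne hca
  refine ⟨by norm_num, ?_, ?_⟩
  · change Function.Injective (![a, b, c] : Fin 3 → V)
    intro i j hij
    fin_cases i <;> fin_cases j <;>
      simp [h₁, h₂, h₃, h₁.symm, h₂.symm, h₃.symm] at hij ⊢
  · change ∀ i : Fin 3, ((![a, b, c] : Fin 3 → V) i, (![a, b, c] : Fin 3 → V) (i + 1)) ∈ A
    intro i
    fin_cases i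
    · exact hab
    · exact hbc
    · exact hca

/-- If `s` lies on no triangle, the out-neighbourhood of `s` is closed under reachability. -/
theorem IsTournament.mem_of_reach {V : Type*} {A : Set (V × V)} (hT : IsTournament A)
    {S : Set V} (hS : ¬ HasSTriangle A S) {s b c : V} (hs : s ∈ S) (hsb : (s, b) ∈ A)
    (hbc : Reach A b c) : (s, c) ∈ A := by
  induction hbc with
  | refl => exact hsb
  | @tail x y _ hxy ih =>
    by_cases hys : s = y
    · subst hys
      exact absurd hxy (hT.asymm ih)
    · refine (hT.mem_or_mem hys).resolve_right fun hy => hS ?_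
      exact ⟨_, hT.isCycle_triangle ih hxy hy, (0 : Fin 3), hs⟩

theorem IsTournament.eq_of_reach {V : Type*} {A : Set (V × V)} (hT : IsTournament A)
    {S : Set V} (hS : ¬ HasSTriangle A S) {s v : V} (hs : s ∈ S) (hsv : Reach A s v)
    (hvs : Reach A v s) : v = s := by
  rcases Relation.ReflTransGen.cases_head hsv with h | ⟨b, hsb, hbv⟩
  · exact h.symm
  · exact absurd (hT.mem_of_reach hS hs hsb (Relation.ReflTransGen.trans hbv hvs)) (hT.1 s)

theorem reachIn_of_reach {V : Type*} {A : Set (V × V)} {W : Set V} {u v : V}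
    (hW : ∀ w, Reach A u w → Reach A w v → w ∈ W) (h : Reach A u v) : ReachIn A W u v := by
  induction h with
  | refl => exact .refl
  | @tail x y hux hxy ih =>
    refine .tail (ih fun w h₁ h₂ => hW w h₁ (h₂.tail hxy)) ⟨?_, ?_, hxy⟩
    · exact hW x hux (.single hxy)
    · exact hW y (hux.tail hxy) .refl

/-- The number of vertices from which `u` can be reached. -/
noncomputable def reachRank {V : Type*} (A : Set (V × V)) (u : V) : ℕ :=
  {w | Reach A w u}.ncard

theorem reachRank_lt {V : Type*} [Finite V] {A : Set (V × V)} {u v : V}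
    (huv : Reach A u v) (hvu : ¬ Reach A v u) : reachRank A u < reachRank A v := by
  apply Set.ncard_lt_ncard _ (Set.toFinite _)
  exact ⟨fun w hw => Relation.ReflTransGen.trans hw huv,
    fun h => hvu (h (show Reach A v v from .refl))⟩

theorem reachRank_eq {V : Type*} {A : Set (V × V)} {u v : V}
    (huv : Reach A u v) (hvu : Reach A v u) : reachRank A u = reachRank A v := by
  unfold reachRank
  congr 1
  ext w
  exact ⟨fun h => Relation.ReflTransGen.trans h huv, fun h => Relation.ReflTransGen.trans h hvu⟩

theorem IsTournament.reach_of_reachRank_le {V : Type*} [Finite V] {A : Set (V × V)}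
    (hT : IsTournament A) {u v : V} (h : reachRank A u ≤ reachRank A v) : Reach A u v := by
  by_cases huv : u = v
  · subst huv
    exact .refl
  by_contra hn
  have hvu : Reach A v u :=
    .single ((hT.mem_or_mem huv).resolve_left fun h => hn (.single h))
  exact (reachRank_lt hvu hn).not_ge h

theorem IsTournament.mem_of_reachRank_lt {V : Type*} [Finite V] {A : Set (V × V)}
    (hT : IsTournament A) {u v : V} (h : reachRank A u < reachRank A v) : (u, v) ∈ A := by
  have hne : u ≠ v := by
    rintro rfl
    exact h.ne rfl
  refine (hT.mem_or_mem hne).resolve_right fun hvu => h.ne ?_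
  exact reachRank_eq (hT.reach_of_reachRank_le h.le) (.single hvu)

theorem IsTournament.isSCC_reachRank_fiber {V : Type*} [Finite V] {A : Set (V × V)}
    (hT : IsTournament A) (u : V) : IsSCC A {w | reachRank A w = reachRank A u} := by
  refine ⟨⟨u, rfl⟩, ?_, ?_⟩
  · intro x (hx : reachRank A x = _) y (hy : reachRank A y = _)
    refine reachIn_of_reach (fun w hxw hwy => ?_)
      (hT.reach_of_reachRank_le (hx.trans hy.symm).le)
    have hyx := hT.reach_of_reachRank_le (hy.trans hx.symm).le
    exact (reachRank_eq (Relation.ReflTransGen.trans hwy hyx) hxw).trans hx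
  · intro W' hsub hW'
    refine Set.Subset.antisymm (fun w hw => ?_) hsub
    have hu : u ∈ W' := hsub rfl
    exact reachRank_eq (hW' w hw u hu).reach (hW' u hu w hw).reach

/-- A tournament admits an `S`-topological ordering (an ordered
partition `V₁ ⊎ ⋯ ⊎ V_ℓ` such that every `s ∈ S` forms a singleton part, every
part is a strongly connected component, and all arcs between different parts go
forward) iff it contains no `S`-triangle. -/
theorem stmt_3 {V : Type*} [Fintype V] (A : Set (V × V)) (hT : IsTournament A)
    (S : Set V) :
    (∃ (ℓ : ℕ) (P : Fin ℓ → Set V),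
        (∀ i j, i ≠ j → Disjoint (P i) (P j)) ∧
        (⋃ i, P i) = Set.univ ∧
        (∀ s ∈ S, ∃ i, P i = {s}) ∧
        (∀ i, IsSCC A (P i)) ∧
        (∀ i j : Fin ℓ, i < j → ∀ u ∈ P i, ∀ v ∈ P j, (u, v) ∈ A)) ↔
      ¬ HasSTriangle A S := by
  constructor
  · rintro ⟨ℓ, P, -, hcov, hsing, -, hord⟩ ⟨f, ⟨-, hinj, harc⟩, i, hi⟩
    obtain ⟨p, hp⟩ := hsing _ hi
    have hpart : ∀ v, ∃ j, v ∈ P j := fun v =>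
      Set.mem_iUnion.1 (hcov ▸ Set.mem_univ v)
    obtain ⟨q, hq⟩ := hpart (f (i + 1))
    obtain ⟨r, hr⟩ := hpart (f (i + 1 + 1))
    have hfp : f i ∈ P p := hp ▸ rfl
    have hne₁ : ∀ k : ZMod 3, k + 1 ≠ k := by decide
    have hne₂ : ∀ k : ZMod 3, k + 1 + 1 ≠ k := by decide
    have hadd : ∀ k : ZMod 3, k + 1 + 1 + 1 = k := by decide
    have hback : (f (i + 1 + 1), f i) ∈ A := by
      have h := harc (i + 1 + 1)
      rwa [hadd] at h
    have hpq : p < q := by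
      rcases lt_trichotomy p q with h | h | h
      · exact h
      · subst h
        rw [hp] at hq
        exact absurd (hinj hq) (hne₁ i)
      · exact absurd (harc i) (hT.asymm (hord _ _ h _ hq _ hfp))
    have hrp : r < p := by
      rcases lt_trichotomy r p with h | h | h
      · exact h
      · subst h
        rw [hp] at hr
        exact absurd (hinj hr) (hne₂ i)
      · exact absurd hback (hT.asymm (hord _ _ h _ hfp _ hr))
    exact hT.asymm (hord _ _ (hrp.trans hpq) _ hr _ hq) (harc (i + 1))
  · intro hS
    classical
    let I : Finset ℕ := Finset.univ.image (reachRank A)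
    let e : Fin I.card ≃o I := I.orderIsoOfFin rfl
    have hcov : ∀ v, ∃ i, reachRank A v = e i := fun v => by
      have hv : reachRank A v ∈ I := Finset.mem_image_of_mem _ (Finset.mem_univ v)
      exact ⟨e.symm ⟨_, hv⟩, by simp⟩
    refine ⟨I.card, fun i => {v | reachRank A v = e i}, ?_, ?_, ?_, ?_, ?_⟩
    · intro i j hij
      refine Set.disjoint_left.2 fun v hvi hvj => hij (e.injective (Subtype.ext ?_))
      exact Eq.trans (Eq.symm hvi) hvj
    · exact Set.eq_univ_of_forall fun v => Set.mem_iUnion.2 (hcov v)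
    · intro s hs
      obtain ⟨i, hi⟩ := hcov s
      refine ⟨i, Set.Subset.antisymm (fun v hv => ?_) ?_⟩
      · have hvs : reachRank A v = reachRank A s := Eq.trans hv hi.symm
        exact hT.eq_of_reach hS hs (hT.reach_of_reachRank_le hvs.ge)
          (hT.reach_of_reachRank_le hvs.le)
      · rintro _ rfl
        exact hi
    · intro i
      obtain ⟨v, -, hv⟩ := Finset.mem_image.1 (e i).2
      beta_reduce
      rw [← hv]
      exact hT.isSCC_reachRank_fiber v
    · intro i j hij u (hu : reachRank A u = _) v (hv : reachRank A v = _)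
      apply hT.mem_of_reachRank_lt
      rw [hu, hv]
      exact e.strictMono hij
end

section
/- Let T be a tournament, S ⊆ V(T), and k a nonnegative integer. Suppose that every vertex of S lies on some directed cycle of T on exactly three vertices, and that no arc of T is contained in more than k distinct S-triangles. If there exists F ⊆ A(T) with |F| ≤ k such that T ⊛ F is S-acyclic, then |S| ≤ k² + 2k. -/
/-- `u, v, w` form an `S`-triangle containing the arc `(u,v)`: the three arcs
`(u,v), (v,w), (w,u)` are present and one of the vertices is in `S`.
The `S`-triangles containing the arc `(u,v)` are in bijection with such
third vertices `w`. -/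
def IsSTriThrough {V : Type*} (A : Set (V × V)) (S : Set V) (u v w : V) : Prop :=
  (u, v) ∈ A ∧ (v, w) ∈ A ∧ (w, u) ∈ A ∧ (u ∈ S ∨ v ∈ S ∨ w ∈ S)

/-- if every vertex of `S` lies on a directed triangle of `T`, no
arc lies in more than `k` distinct `S`-triangles, and some `F ⊆ A(T)` with
`|F| ≤ k` reversed makes `T` `S`-acyclic, then `|S| ≤ k² + 2k`. -/
theorem stmt_6 {V : Type*} [Fintype V] (A : Set (V × V)) (hT : IsTournament A)
    (S : Set V) (k : ℕ)
    (htri : ∀ s ∈ S, ∃ f : ZMod 3 → V, IsCycle A 3 f ∧ ∃ i, f i = s)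
    (hfew : ∀ u v : V, (u, v) ∈ A → {w | IsSTriThrough A S u v w}.ncard ≤ k)
    (hsol : ∃ F ⊆ A, F.ncard ≤ k ∧ SAcyclic (revArcs A F) S) :
    S.ncard ≤ k ^ 2 + 2 * k := by
  obtain ⟨F, hFA, hFk, hF⟩ := hsol
  have hFfin : F.Finite := Set.toFinite F
  have hcover : S ⊆ (Prod.fst '' F ∪ Prod.snd '' F) ∪
      ⋃ p ∈ hFfin.toFinset, {w | IsSTriThrough A S p.1 p.2 w} := by
    intro s hs
    obtain ⟨f, ⟨h2, hinj, harc⟩, j, rfl⟩ := htri s hs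
    obtain ⟨i, hi⟩ : ∃ i, (f i, f (i + 1)) ∈ F := by
      by_contra! h
      exact hF ⟨3, f, ⟨h2, hinj, fun i => ⟨Or.inl (harc i), h i⟩⟩, j, hs⟩
    have hj : ∀ i j : ZMod 3, j = i ∨ j = i + 1 ∨ j = i + 1 + 1 := by decide
    rcases hj i j with rfl | rfl | rfl
    · exact Or.inl (Or.inl ⟨_, hi, rfl⟩)
    · exact Or.inl (Or.inr ⟨_, hi, rfl⟩)
    · refine Or.inr (Set.mem_biUnion (hFfin.mem_toFinset.2 hi)
        ⟨hFA hi, harc (i + 1), ?_, Or.inr (Or.inr hs)⟩)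
      have h3 : ∀ i : ZMod 3, i + 1 + 1 + 1 = i := by decide
      simpa only [h3] using harc (i + 1 + 1)
  have hthird : (⋃ p ∈ hFfin.toFinset, {w | IsSTriThrough A S p.1 p.2 w}).ncard ≤ k * k := by
    calc _ ≤ ∑ p ∈ hFfin.toFinset, {w | IsSTriThrough A S p.1 p.2 w}.ncard :=
          Finset.set_ncard_biUnion_le _ _
      _ ≤ hFfin.toFinset.card * k :=
          Finset.sum_le_card_nsmul _ _ _ fun p hp => hfew _ _ (hFA (hFfin.mem_toFinset.1 hp))
      _ ≤ k * k := by
          rw [← Set.ncard_eq_toFinset_card F hFfin]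
          gcongr
  have hfst : (Prod.fst '' F).ncard ≤ k := (Set.ncard_image_le hFfin).trans hFk
  have hsnd : (Prod.snd '' F).ncard ≤ k := (Set.ncard_image_le hFfin).trans hFk
  have hends := Set.ncard_union_le (Prod.fst '' F) (Prod.snd '' F)
  have hall := (Set.ncard_le_ncard hcover (Set.toFinite _)).trans (Set.ncard_union_le _ _)
  rw [sq]
  omega
end

section
/- Let T be a tournament with n vertices, S ⊆ V(T), and let C be a maximal (under inclusion) collection of pairwise arc-disjoint S-triangles of T. Let V(C) denote the set of vertices covered by triangles of C, A(C) the set of arcs of triangles of C, and S₁ = S \ V(C). Then there exists a linear ordering σ = v₁, …, v_n of V(T) such that every S₁-backward arc of T with respect to σ belongs to A(C). -/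
/-- The three arcs of the triangle represented by the triple `t = (u, v, w)`. -/
def triArcs {V : Type*} (t : V × V × V) : Set (V × V) :=
  {(t.1, t.2.1), (t.2.1, t.2.2), (t.2.2, t.1)}

/-- The triple `t = (u, v, w)` is an `S`-triangle of the digraph with arc set
`A`: the arcs `(u,v), (v,w), (w,u)` are present and some vertex is in `S`. -/
def IsSTri {V : Type*} (A : Set (V × V)) (S : Set V) (t : V × V × V) : Prop :=
  (t.1, t.2.1) ∈ A ∧ (t.2.1, t.2.2) ∈ A ∧ (t.2.2, t.1) ∈ A ∧
    (t.1 ∈ S ∨ t.2.1 ∈ S ∨ t.2.2 ∈ S)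

/-- The set of vertices covered by a collection `C` of triangles (triples). -/
def triVerts {V : Type*} (C : Set (V × V × V)) : Set V :=
  ⋃ t ∈ C, ({t.1, t.2.1, t.2.2} : Set V)

/-- Every `S`-triangle shares an arc with a maximal arc-disjoint collection of `S`-triangles. -/
theorem exists_arc_mem_of_isSTri {V : Type*} {A : Set (V × V)} {S : Set V} {C : Set (V × V × V)}
    (hC : ∀ t ∈ C, IsSTri A S t)
    (hdisj : ∀ t₁ ∈ C, ∀ t₂ ∈ C, t₁ ≠ t₂ → Disjoint (triArcs t₁) (triArcs t₂))
    (hmax : ∀ C' : Set (V × V × V), C ⊆ C' → (∀ t ∈ C', IsSTri A S t) →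
      (∀ t₁ ∈ C', ∀ t₂ ∈ C', t₁ ≠ t₂ → Disjoint (triArcs t₁) (triArcs t₂)) →
      C' = C)
    {t : V × V × V} (ht : IsSTri A S t) :
    ∃ a ∈ triArcs t, a ∈ ⋃ t ∈ C, triArcs t := by
  by_contra! h
  have hd : ∀ t' ∈ C, Disjoint (triArcs t) (triArcs t') := fun t' ht' =>
    Set.disjoint_left.2 fun a ha ha' => h a ha (Set.mem_biUnion ht' ha')
  have hins : insert t C = C := by
    refine hmax _ (Set.subset_insert t C) ?_ ?_
    · rintro t' (rfl | ht')
      exacts [ht, hC _ ht']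
    · rintro t₁ (rfl | h₁) t₂ (rfl | h₂) hne
      exacts [absurd rfl hne, hd _ h₂, (hd _ h₁).symm, hdisj _ h₁ _ h₂ hne]
  have htC : t ∈ C := hins ▸ Set.mem_insert t C
  exact h (t.1, t.2.1) (by simp [triArcs]) (Set.mem_biUnion htC (by simp [triArcs]))

/-- Both ends of an arc of a collection of triangles are covered by the collection. -/
theorem mem_triVerts_of_mem_triArcs {V : Type*} {C : Set (V × V × V)} {u v : V}
    (h : (u, v) ∈ ⋃ t ∈ C, triArcs t) : u ∈ triVerts C ∧ v ∈ triVerts C := by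
  obtain ⟨t, ht, h⟩ := Set.mem_iUnion₂.1 h
  simp only [triArcs, Set.mem_insert_iff, Set.mem_singleton_iff, Prod.mk.injEq] at h
  constructor <;> refine Set.mem_biUnion ht ?_ <;>
    simp only [Set.mem_insert_iff, Set.mem_singleton_iff] <;> tauto

/-- A finite type can be listed in nondecreasing order of any function to a linear order. -/
theorem exists_equivFin_le_of_lt {V α : Type*} [Fintype V] [LinearOrder α] (g : V → α) :
    ∃ σ : V ≃ Fin (Fintype.card V), ∀ x y, σ x < σ y → g x ≤ g y := by
  let e := Fintype.equivFin V
  refine ⟨e.trans (Tuple.sort (g ∘ e.symm)).symm, fun x y h => ?_⟩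
  simpa using Tuple.monotone_sort (g ∘ e.symm) h.le

/-- Conflict packing lemma: for a maximal collection `C` of
pairwise arc-disjoint `S`-triangles of a tournament `T` and `S₁ = S \ V(C)`,
there is a linear ordering `σ` of `V(T)` such that every `S₁`-backward arc of
`T` with respect to `σ` belongs to `A(C)`. An arc `(x,y)` with `σ y < σ x` is
`S₁`-backward if `y ∈ S₁`, or `x ∈ S₁`, or some `q ∈ S₁` lies strictly between
`y` and `x` in `σ`. -/
theorem stmt_9 {V : Type*} [Fintype V] (A : Set (V × V)) (hT : IsTournament A)
    (S : Set V) (C : Set (V × V × V))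
    (hC : ∀ t ∈ C, IsSTri A S t)
    (hdisj : ∀ t₁ ∈ C, ∀ t₂ ∈ C, t₁ ≠ t₂ → Disjoint (triArcs t₁) (triArcs t₂))
    (hmax : ∀ C' : Set (V × V × V), C ⊆ C' → (∀ t ∈ C', IsSTri A S t) →
      (∀ t₁ ∈ C', ∀ t₂ ∈ C', t₁ ≠ t₂ → Disjoint (triArcs t₁) (triArcs t₂)) →
      C' = C) :
    ∃ σ : V ≃ Fin (Fintype.card V),
      ∀ x y : V, (x, y) ∈ A → σ y < σ x →
        (y ∈ S \ triVerts C ∨ x ∈ S \ triVerts C ∨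
          ∃ q, σ y < σ q ∧ σ q < σ x ∧ q ∈ S \ triVerts C) →
        (x, y) ∈ ⋃ t ∈ C, triArcs t := by
  classical
  have htri : ∀ q u v, q ∈ S \ triVerts C → (q, u) ∈ A → (u, v) ∈ A → (v, q) ∈ A →
      (u, v) ∈ ⋃ t ∈ C, triArcs t := by
    intro q u v hq h₁ h₂ h₃
    obtain ⟨a, ha, haC⟩ := exists_arc_mem_of_isSTri hC hdisj hmax
      (t := (q, u, v)) ⟨h₁, h₂, h₃, Or.inl hq.1⟩
    simp only [triArcs, Set.mem_insert_iff, Set.mem_singleton_iff] at ha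
    rcases ha with rfl | rfl | rfl
    · exact absurd (mem_triVerts_of_mem_triArcs haC).1 hq.2
    · exact haC
    · exact absurd (mem_triVerts_of_mem_triArcs haC).2 hq.2
  have htrans : ∀ p q v, p ∈ S \ triVerts C → q ∈ S \ triVerts C →
      (p, q) ∈ A → (q, v) ∈ A → (p, v) ∈ A := by
    intro p q v hp hq hpq hqv
    by_contra hpv
    rcases eq_or_ne p v with rfl | hne
    · exact (hT.2 p q (by rintro rfl; exact hT.1 _ hpq)).1 hpq hqv
    · have hvp : (v, p) ∈ A := (hT.2 v p hne.symm).2 hpv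
      exact hq.2 (mem_triVerts_of_mem_triArcs (htri p q v hp hpq hqv hvp)).1
  let N : V → Finset V := fun v => {p | p ∈ S \ triVerts C ∧ (p, v) ∈ A}
  let g : V → ℕ := fun v => 2 * (N v).card + if v ∈ S \ triVerts C then 1 else 0
  have hout : ∀ q v, q ∈ S \ triVerts C → (q, v) ∈ A → g q < g v := by
    intro q v hq hqv
    have hlt : (N q).card < (N v).card := by
      refine Finset.card_lt_card ((Finset.ssubset_iff_of_subset fun p hp => ?_).2 ⟨q, ?_, ?_⟩)
      · simp only [N, Finset.mem_filter_univ] at hp ⊢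
        exact ⟨hp.1, htrans p q v hp.1 hq hp.2 hqv⟩
      · simpa only [N, Finset.mem_filter_univ] using ⟨hq, hqv⟩
      · simp only [N, Finset.mem_filter_univ]
        exact fun h => hT.1 q h.2
    simp only [g]
    split_ifs <;> omega
  have hin : ∀ q v, q ∈ S \ triVerts C → (v, q) ∈ A → g v < g q := by
    intro q v hq hvq
    by_cases hv : v ∈ S \ triVerts C
    · exact hout v q hv hvq
    have hle : (N v).card ≤ (N q).card := by
      refine Finset.card_le_card fun p hp => ?_
      simp only [N, Finset.mem_filter_univ] at hp ⊢
      refine ⟨hp.1, ?_⟩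
      by_contra hpq
      rcases eq_or_ne p q with rfl | hne
      · exact (hT.2 p v (by rintro rfl; exact hT.1 _ hvq)).1 hp.2 hvq
      · exact hpq ((hT.2 p q hne).2 fun hqp =>
          hq.2 (mem_triVerts_of_mem_triArcs (htri p v q hp.1 hp.2 hvq hqp)).2)
    simp only [g, if_pos hq, if_neg hv]
    omega
  obtain ⟨σ, hσ⟩ := exists_equivFin_le_of_lt g
  refine ⟨σ, fun x y hxy hlt h => ?_⟩
  rcases h with hy | hx | ⟨q, hyq, hqx, hq⟩
  · exact absurd (hin y x hy hxy) (hσ y x hlt).not_gt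
  · exact absurd (hout x y hx hxy) (hσ y x hlt).not_gt
  · refine htri q x y hq ?_ hxy ?_
    · exact (hT.2 q x (by rintro rfl; exact hqx.false)).2 fun h =>
        (hσ q x hqx).not_gt (hin q x hq h)
    · exact (hT.2 y q (by rintro rfl; exact hyq.false)).2 fun h =>
        (hσ y q hyq).not_gt (hout q y hq h)
end

section
/- Let T be a tournament with a linear ordering σ of its vertices, S ⊆ V(T), and let P_σ = (V₁, …, V_ℓ) be an ordered partition of V(T) into intervals of σ. Let A_B be the set of arcs with endpoints in different parts, A_I = A(T) \ A_B, and B_E the set of backward arcs belonging to A_B. If P_σ is an S-safe partition, then Sfas(T) = Sfas((V(T), A_I)) + Sfas((V(T), A_B)); moreover, there exists a minimum-size S-feedback arc set of T that contains B_E. -/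
/-- `Sfas A S` is the minimum size of an `S`-feedback arc set of the digraph
with arc set `A`: the least `n` such that some `F ⊆ A` with `|F| ≤ n` has
`A \ F` `S`-acyclic. -/
noncomputable def Sfas {V : Type*} (A : Set (V × V)) (S : Set V) : ℕ :=
  sInf {n | ∃ F ⊆ A, F.ncard ≤ n ∧ SAcyclic (A \ F) S}

/-- The list of consecutive arcs of a path given as a list of vertices. -/
def pathArcs {V : Type*} (l : List V) : List (V × V) :=
  l.zip l.tail

theorem SAcyclic.anti {V : Type*} {A B : Set (V × V)} {S : Set V} (h : SAcyclic B S)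
    (hAB : A ⊆ B) : SAcyclic A S := by
  rintro ⟨n, f, ⟨hn, hf, hA⟩, hS⟩
  exact h ⟨n, f, ⟨hn, hf, fun i => hAB (hA i)⟩, hS⟩

/-- A function that is weakly increasing around a cycle is constant. -/
theorem ZMod.eq_of_forall_le_add_one {α : Type*} [PartialOrder α] {n : ℕ} [NeZero n]
    {g : ZMod n → α} (hg : ∀ i, g i ≤ g (i + 1)) (i j : ZMod n) : g i = g j := by
  have key : ∀ (i : ZMod n) (k : ℕ), g i ≤ g (i + k) := by
    intro i k
    induction k with
    | zero => simp
    | succ k ih =>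
      refine ih.trans ?_
      have := hg (i + k)
      rwa [add_assoc, ← Nat.cast_succ] at this
  have hle : ∀ i j : ZMod n, g i ≤ g j := by
    intro i j
    have := key i (j - i).val
    rwa [ZMod.natCast_zmod_val, add_sub_cancel] at this
  exact le_antisymm (hle i j) (hle j i)

/-- A digraph all of whose arcs go forward in some order has no `S`-cycle. -/
theorem sAcyclic_of_forall_lt {V α : Type*} [PartialOrder α] {A : Set (V × V)} (S : Set V)
    (g : V → α) (hg : ∀ p ∈ A, g p.1 < g p.2) : SAcyclic A S := by
  rintro ⟨n, f, ⟨hn, -, hA⟩, -⟩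
  have : NeZero n := ⟨by omega⟩
  have hlt : ∀ i, g (f i) < g (f (i + 1)) := fun i => hg _ (hA i)
  exact (hlt 0).ne (ZMod.eq_of_forall_le_add_one (g := fun i => g (f i)) (fun i => (hlt i).le) _ _)

theorem sfas_le_ncard {V : Type*} {A F : Set (V × V)} {S : Set V} (hF : F ⊆ A)
    (h : SAcyclic (A \ F) S) : Sfas A S ≤ F.ncard :=
  Nat.sInf_le ⟨F, hF, le_rfl, h⟩

theorem exists_ncard_eq_sfas {V : Type*} (A : Set (V × V)) (S : Set V) :
    ∃ F ⊆ A, F.ncard = Sfas A S ∧ SAcyclic (A \ F) S := by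
  have hne : {n | ∃ F ⊆ A, F.ncard ≤ n ∧ SAcyclic (A \ F) S}.Nonempty :=
    ⟨A.ncard, A, subset_rfl, le_rfl, by
      rw [Set.sdiff_self]
      exact sAcyclic_of_forall_lt S (fun _ => 0) (by simp)⟩
  obtain ⟨F, hF, hle, hac⟩ := Nat.sInf_mem hne
  exact ⟨F, hF, hle.antisymm (sfas_le_ncard hF hac), hac⟩

/-- A path through `S` together with an arc from its end to its start is an `S`-cycle. -/
theorem hasSCycle_of_path {V : Type*} {A : Set (V × V)} {S : Set V} {l : List V} {p : V × V}
    (hpA : p ∈ A) (hne : p.1 ≠ p.2) (hhead : l.head? = some p.2) (hlast : l.getLast? = some p.1)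
    (hnd : l.Nodup) (harcs : ∀ e ∈ pathArcs l, e ∈ A) (hS : ∃ w ∈ l, w ∈ S) :
    HasSCycle A S := by
  have hlen : 2 ≤ l.length := by
    match l with
    | [] => simp at hhead
    | [a] => simp at hhead hlast; exact absurd (hlast.symm.trans hhead) hne
    | _ :: _ :: _ => simp
  have : NeZero l.length := ⟨by omega⟩
  refine ⟨l.length, fun i => l[i.val]'(ZMod.val_lt i), ⟨hlen, ?_, ?_⟩, ?_⟩
  · intro i j hij
    exact ZMod.val_injective _ ((hnd.getElem_inj_iff).1 hij)
  · intro i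
    have hi := ZMod.val_lt i
    by_cases h : i.val + 1 < l.length
    · have hv : (i + 1).val = i.val + 1 := by
        rw [← ZMod.val_cast_of_lt h, Nat.cast_succ, ZMod.natCast_zmod_val]
      apply harcs
      simp only [hv]
      rw [pathArcs, List.mem_iff_getElem]
      exact ⟨i.val, by simp; omega, by simp⟩
    · have h1 : i.val = l.length - 1 := by omega
      have h2 : (i + 1).val = 0 := by
        rw [ZMod.val_eq_zero, ← ZMod.natCast_zmod_val i, ← Nat.cast_succ,
          show i.val.succ = l.length by omega, ZMod.natCast_self]
      have h3 : l[l.length - 1]'(by omega) = p.1 := by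
        rw [List.getLast?_eq_getElem?] at hlast
        exact (List.getElem?_eq_some_iff.1 hlast).2
      have h4 : l[0]'(by omega) = p.2 := by
        rw [List.head?_eq_getElem?] at hhead
        exact (List.getElem?_eq_some_iff.1 hhead).2
      simpa only [h1, h2, h3, h4] using hpA
  · obtain ⟨w, hw, hwS⟩ := hS
    obtain ⟨k, hk, rfl⟩ := List.mem_iff_getElem.1 hw
    refine ⟨(k : ZMod l.length), ?_⟩
    simpa only [ZMod.val_cast_of_lt hk] using hwS

theorem rel_of_mem_pathArcs {V : Type*} {R : V → V → Prop} {l : List V} (h : l.IsChain R)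
    {e : V × V} (he : e ∈ pathArcs l) : R e.1 e.2 := by
  rw [pathArcs, List.mem_iff_getElem] at he
  obtain ⟨k, hk, rfl⟩ := he
  have hk' : k + 1 < l.length := by simp at hk; omega
  simpa using List.isChain_iff_getElem.1 h k hk'

/-- Safe partition lemma: let `σ` order `V(T)`, let
`P₁, …, P_ℓ` be an ordered partition of `V(T)` into intervals of `σ`, let `AB`
be the external arcs, `AI` the internal arcs and `BE` the backward external
arcs. If the partition is `S`-safe, i.e. there is a family of pairwise
arc-disjoint certificates (a certificate of a backward arc `(x,y)` is a
directed path from `y` to `x` through a vertex of `S` using only forward arcs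
of `AB`), then `Sfas(T) = Sfas(AI) + Sfas(AB)`, and some minimum-size
`S`-feedback arc set of `T` contains `BE`. -/
theorem stmt_10 {V : Type*} [Fintype V] (A : Set (V × V)) (hT : IsTournament A)
    (S : Set V) (σ : V ≃ Fin (Fintype.card V)) (ℓ : ℕ) (P : Fin ℓ → Set V)
    (hdisj : ∀ i j, i ≠ j → Disjoint (P i) (P j))
    (hcover : (⋃ i, P i) = Set.univ)
    (hord : ∀ i j : Fin ℓ, i < j → ∀ u ∈ P i, ∀ v ∈ P j, σ u < σ v)
    (AB AI BE : Set (V × V))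
    (hAB : AB = {p ∈ A | ¬ ∃ i, p.1 ∈ P i ∧ p.2 ∈ P i})
    (hAI : AI = A \ AB)
    (hBE : BE = {p ∈ AB | σ p.2 < σ p.1})
    (c : V × V → List V)
    (hcert : ∀ p ∈ BE,
      (c p).head? = some p.2 ∧ (c p).getLast? = some p.1 ∧ (c p).Nodup ∧
        (c p).Chain' (fun a b => (a, b) ∈ AB ∧ σ a < σ b) ∧ ∃ w ∈ c p, w ∈ S)
    (hcertdisj : ∀ p ∈ BE, ∀ q ∈ BE, p ≠ q →
      ∀ e ∈ pathArcs (c p), e ∉ pathArcs (c q)) :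
    Sfas A S = Sfas AI S + Sfas AB S ∧
      ∃ F ⊆ A, F.ncard = Sfas A S ∧ SAcyclic (A \ F) S ∧ BE ⊆ F := by
  choose part hpart using fun v : V => Set.mem_iUnion.1 (hcover ▸ Set.mem_univ v)
  have part_eq : ∀ {i v}, v ∈ P i → part v = i := by
    intro i v hv
    by_contra hne
    exact Set.disjoint_left.1 (hdisj _ _ hne) (hpart v) hv
  have mem_AI : ∀ {p : V × V}, p ∈ A → part p.1 = part p.2 → p ∈ AI := by
    intro p hp h
    rw [hAI, hAB]
    exact ⟨hp, fun h' => h'.2 ⟨part p.1, hpart _, h ▸ hpart _⟩⟩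
  have hABA : AB ⊆ A := hAB ▸ Set.sep_subset _ _
  have hAIA : AI ⊆ A := hAI ▸ Set.sdiff_subset
  have hBEAB : BE ⊆ AB := hBE ▸ Set.sep_subset _ _
  have back : ∀ p ∈ BE, σ p.2 < σ p.1 := by
    intro p hp
    rw [hBE] at hp
    exact hp.2
  have forward : ∀ p ∈ AB \ BE, part p.1 < part p.2 := by
    rintro p ⟨hp, hpBE⟩
    have hnb : ¬ σ p.2 < σ p.1 := fun h => hpBE (hBE ▸ ⟨hp, h⟩)
    refine lt_of_le_of_ne (not_lt.1 fun h => hnb (hord _ _ h _ (hpart _) _ (hpart _))) fun h => ?_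
    rw [hAB] at hp
    exact hp.2 ⟨part p.1, hpart _, h ▸ hpart _⟩
  have lower : ∀ F : Set (V × V), SAcyclic (AB \ F) S → BE.ncard ≤ (F ∩ AB).ncard := by
    intro F hF
    have hit : ∀ p ∈ BE, ∃ e ∈ F ∩ AB, e = p ∨ e ∈ pathArcs (c p) := by
      intro p hp
      obtain ⟨hh, hl, hnd, hch, hS⟩ := hcert p hp
      by_contra! hcon
      refine hF (hasSCycle_of_path ⟨hBEAB hp, fun h => (hcon p ⟨h, hBEAB hp⟩).1 rfl⟩
        (fun h => (back p hp).ne (by rw [h])) hh hl hnd (fun e he => ?_) hS)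
      have heAB : e ∈ AB := (rel_of_mem_pathArcs hch he).1
      exact ⟨heAB, fun h => (hcon e ⟨h, heAB⟩).2 he⟩
    choose! g hgF hg using hit
    refine Set.ncard_le_ncard_of_injOn g hgF (fun p hp q hq hpq => ?_) (Set.toFinite _)
    have not_path : ∀ p ∈ BE, ∀ q ∈ BE, p ∉ pathArcs (c q) := fun p hp q hq h =>
      (back p hp).not_gt (rel_of_mem_pathArcs (hcert q hq).2.2.2.1 h).2
    by_contra hne
    rcases hg p hp with h1 | h1 <;> rcases hg q hq with h2 | h2
    · exact hne (h1.symm.trans (hpq.trans h2))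
    · exact not_path p hp q hq (h1 ▸ hpq ▸ h2)
    · exact not_path q hq p hp (h2 ▸ hpq ▸ h1)
    · exact hcertdisj p hp q hq hne _ h1 (hpq ▸ h2)
  have hsfasAB : Sfas AB S = BE.ncard := by
    refine (sfas_le_ncard hBEAB (sAcyclic_of_forall_lt S part forward)).antisymm ?_
    obtain ⟨F, hFAB, hcard, hac⟩ := exists_ncard_eq_sfas AB S
    simpa [Set.inter_eq_left.2 hFAB, hcard] using lower F hac
  obtain ⟨FI, hFI, hFIcard, hFIac⟩ := exists_ncard_eq_sfas AI S
  have hdisjI : Disjoint AI AB := hAI ▸ Set.disjoint_sdiff_left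
  have hsub : FI ∪ BE ⊆ A := Set.union_subset (hFI.trans hAIA) (hBEAB.trans hABA)
  have hcard : (FI ∪ BE).ncard = Sfas AI S + Sfas AB S := by
    rw [Set.ncard_union_eq (hdisjI.mono hFI hBEAB), hFIcard, hsfasAB]
  have hac : SAcyclic (A \ (FI ∪ BE)) S := by
    rintro ⟨n, f, ⟨hn, hf, hA⟩, hS⟩
    have : NeZero n := ⟨by omega⟩
    have hle : ∀ i, part (f i) ≤ part (f (i + 1)) := by
      intro i
      by_cases h : (f i, f (i + 1)) ∈ AB
      · exact (forward _ ⟨h, fun h' => (hA i).2 (Or.inr h')⟩).le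
      · have hnot := h
        rw [hAB] at hnot
        obtain ⟨j, h1, h2⟩ := not_not.1 fun h' => hnot ⟨(hA i).1, h'⟩
        exact ((part_eq h1).trans (part_eq h2).symm).le
    refine hFIac ⟨n, f, ⟨hn, hf, fun i => ⟨mem_AI (hA i).1 ?_, fun h => (hA i).2 (Or.inl h)⟩⟩, hS⟩
    exact ZMod.eq_of_forall_le_add_one (g := fun i => part (f i)) hle _ _
  have heq : Sfas A S = Sfas AI S + Sfas AB S := by
    refine (hcard ▸ sfas_le_ncard hsub hac).antisymm ?_
    obtain ⟨F, hFA, hFcard, hFac⟩ := exists_ncard_eq_sfas A S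
    have h1 : Sfas AI S ≤ (F ∩ AI).ncard :=
      sfas_le_ncard Set.inter_subset_right (hFac.anti fun e he =>
        ⟨hAIA he.1, fun h => he.2 ⟨h, he.1⟩⟩)
    have h2 : BE.ncard ≤ (F ∩ AB).ncard := lower F (hFac.anti (Set.sdiff_subset_sdiff_left hABA))
    have h3 : (F ∩ AI ∪ F ∩ AB).ncard ≤ F.ncard :=
      Set.ncard_le_ncard (Set.union_subset Set.inter_subset_left Set.inter_subset_left)
        (Set.toFinite _)
    rw [Set.ncard_union_eq (hdisjI.mono Set.inter_subset_right Set.inter_subset_right)] at h3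
    omega
  exact ⟨heq, FI ∪ BE, hsub, hcard.trans heq.symm, hac, Set.subset_union_right⟩
end

section
/- Let T be a tournament, S ⊆ V(T), k a nonnegative integer, and (u,v) ∈ A(T). If there exist more than k pairwise arc-disjoint directed paths from u to v in T, each containing at least one vertex of S, then every F ⊆ A(T) with |F| ≤ k such that T ⊛ F is S-acyclic satisfies (u,v) ∉ F. -/
/-- The list `l` of vertices is a directed path from `u` to `v` in the digraph
with arc set `A` containing a vertex of `S`. -/
def IsSPath {V : Type*} (A : Set (V × V)) (S : Set V) (u v : V) (l : List V) :
    Prop :=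
  l.head? = some u ∧ l.getLast? = some v ∧ l.Nodup ∧
    l.Chain' (fun a b => (a, b) ∈ A) ∧ ∃ w ∈ l, w ∈ S

theorem getElem_succ_mem_pathArcs {V : Type*} (l : List V) (j : ℕ) (hj : j + 1 < l.length) :
    (l[j], l[j + 1]) ∈ pathArcs l := by
  have h : j < (l.zip l.tail).length := by
    simp only [List.length_zip, List.length_tail]
    omega
  have h' : (l.zip l.tail)[j] = (l[j], l[j + 1]) := by simp
  exact h' ▸ List.getElem_mem h

/-- Among more than `|F|` pairwise arc-disjoint paths, one avoids `F`. -/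
theorem exists_pathArcs_avoiding {V : Type*} {k : ℕ} (paths : Fin (k + 1) → List V)
    (hdisj : ∀ i j, i ≠ j → ∀ e ∈ pathArcs (paths i), e ∉ pathArcs (paths j))
    (F : Set (V × V)) (hfin : F.Finite) (hF : F.ncard ≤ k) :
    ∃ i, ∀ e ∈ pathArcs (paths i), e ∉ F := by
  by_contra! h
  choose g hg hgF using h
  have hinj : Function.Injective g := by
    intro i j hij
    by_contra hne
    exact hdisj i j hne _ (hg i) (hij ▸ hg j)
  have hle : (Set.range g).ncard ≤ F.ncard :=
    Set.ncard_le_ncard (Set.range_subset_iff.2 hgF) hfin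
  have hcard : (Set.range g).ncard = k + 1 := by
    rw [← Set.image_univ, Set.ncard_image_of_injective _ hinj, Set.ncard_univ, Nat.card_fin]
  omega

/-- A path through `S` from `u` to `v`, closed up by the arc `(v, u)`, is an `S`-cycle. -/
theorem IsSPath.hasSCycle {V : Type*} {A : Set (V × V)} {S : Set V} {u v : V} {l : List V}
    (hl : IsSPath A S u v l) (hne : u ≠ v) (hvu : (v, u) ∈ A) : HasSCycle A S := by
  obtain ⟨hhead, hlast, hnodup, hchain, w, hwl, hwS⟩ := hl
  have hlen : 2 ≤ l.length := by
    match l with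
    | [] => simp at hhead
    | [a] => simp_all
    | a :: b :: t => simp
  have hn : NeZero l.length := ⟨by omega⟩
  have h0 : l[0] = u := by
    rw [List.head?_eq_getElem?, List.getElem?_eq_getElem (by omega)] at hhead
    exact Option.some.inj hhead
  have hend : l[l.length - 1] = v := by
    rw [List.getLast?_eq_getElem?, List.getElem?_eq_getElem (by omega)] at hlast
    exact Option.some.inj hlast
  refine ⟨l.length, fun i => l[i.val]'(ZMod.val_lt i), ⟨hlen, ?_, ?_⟩, ?_⟩
  · intro i j hij
    exact ZMod.val_injective _ ((hnodup.getElem_inj_iff).1 hij)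
  · intro i
    have hi := ZMod.val_lt i
    have hone : (1 : ZMod l.length).val = 1 := by
      have : Fact (1 < l.length) := ⟨by omega⟩
      exact ZMod.val_one _
    have hval := ZMod.val_add i 1
    rw [hone] at hval
    by_cases h : i.val + 1 < l.length
    · rw [Nat.mod_eq_of_lt h] at hval
      simp only [hval]
      exact List.isChain_iff_getElem.1 hchain _ h
    · have hi' : i.val = l.length - 1 := by omega
      have hs : i.val + 1 = l.length := by omega
      rw [hs, Nat.mod_self] at hval
      simp only [hval, hi', h0, hend]
      exact hvu
  · obtain ⟨j, hj, rfl⟩ := List.getElem_of_mem hwl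
    exact ⟨(j : ZMod l.length), by simpa only [ZMod.val_cast_of_lt hj] using hwS⟩

/-- Sure arc lemma: if there are more than `k` pairwise
arc-disjoint directed `S`-paths from `u` to `v` in `T`, then every `F ⊆ A(T)`
with `|F| ≤ k` whose reversal makes `T` `S`-acyclic avoids the arc `(u,v)`. -/
theorem stmt_12 {V : Type*} [Fintype V] (A : Set (V × V)) (hT : IsTournament A)
    (S : Set V) (k : ℕ) (u v : V) (huv : (u, v) ∈ A)
    (paths : Fin (k + 1) → List V)
    (hpaths : ∀ i, IsSPath A S u v (paths i))
    (hpdisj : ∀ i j, i ≠ j → ∀ e ∈ pathArcs (paths i), e ∉ pathArcs (paths j)) :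
    ∀ F ⊆ A, F.ncard ≤ k → SAcyclic (revArcs A F) S → (u, v) ∉ F := by
  intro F hFA hFk hac huvF
  have hne : u ≠ v := by
    rintro rfl
    exact hT.1 _ huv
  obtain ⟨i, hi⟩ := exists_pathArcs_avoiding paths hpdisj F F.toFinite hFk
  obtain ⟨hhead, hlast, hnodup, hchain, hS⟩ := hpaths i
  have hpath : IsSPath (revArcs A F) S u v (paths i) := by
    refine ⟨hhead, hlast, hnodup, List.isChain_iff_getElem.2 fun j hj => ?_, hS⟩
    exact ⟨Or.inl (List.isChain_iff_getElem.1 hchain j hj),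
      hi _ (getElem_succ_mem_pathArcs _ j hj)⟩
  exact hac (hpath.hasSCycle hne ⟨Or.inr huvF, fun h => (hT.2 u v hne).1 huv (hFA h)⟩)
end

section
/- Let T be a tournament and S ⊆ V(T). If T is S-acyclic, then the number of distinct sets among {Type(v) : v ∈ V(T) \ S} is at most |S| + 1. -/
/-- In an `S`-acyclic tournament, the types of vertices outside `S` form a chain. -/
theorem SAcyclic.type_subset_or_subset {V : Type*} {A : Set (V × V)} (hT : IsTournament A)
    {S : Set V} (hacyc : SAcyclic A S) {u v : V} (hu : u ∉ S) (hv : v ∉ S) :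
    {s ∈ S | (s, u) ∈ A} ⊆ {s ∈ S | (s, v) ∈ A} ∨
      {s ∈ S | (s, v) ∈ A} ⊆ {s ∈ S | (s, u) ∈ A} := by
  by_contra! h
  obtain ⟨s, ⟨hs, hsu⟩, hsv⟩ := Set.not_subset.mp h.1
  obtain ⟨t, ⟨ht, htv⟩, htu⟩ := Set.not_subset.mp h.2
  replace hsv : (s, v) ∉ A := fun hA => hsv ⟨hs, hA⟩
  replace htu : (t, u) ∉ A := fun hA => htu ⟨ht, hA⟩
  have hne_su : s ≠ u := ne_of_mem_of_not_mem hs hu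
  have hne_sv : s ≠ v := ne_of_mem_of_not_mem hs hv
  have hne_tu : t ≠ u := ne_of_mem_of_not_mem ht hu
  have hne_tv : t ≠ v := ne_of_mem_of_not_mem ht hv
  have hne_st : s ≠ t := by rintro rfl; exact hsv htv
  have hne_uv : u ≠ v := by rintro rfl; exact hsv hsu
  have hvs : (v, s) ∈ A := (hT.2 v s hne_sv.symm).mpr hsv
  have hut : (u, t) ∈ A := (hT.2 u t hne_tu.symm).mpr htu
  let f : Fin 4 → V := ![s, u, t, v]
  have hf : Function.Injective f := by
    intro i j hij
    fin_cases i <;> fin_cases j <;> simp_all [f]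
  have hfA : ∀ i : Fin 4, (f i, f (i + 1)) ∈ A := by
    intro i
    fin_cases i
    exacts [hsu, hut, htv, hvs]
  exact hacyc ⟨4, f, ⟨by norm_num, hf, hfA⟩, (0 : Fin 4), hs⟩

/-- if the tournament `T` is `S`-acyclic, then the number of
distinct sets `Type(v) = {s ∈ S : (s,v) ∈ A}` over `v ∈ V(T) \ S` is at most
`|S| + 1`. -/
theorem stmt_13 {V : Type*} [Fintype V] (A : Set (V × V)) (hT : IsTournament A)
    (S : Set V) (hacyc : SAcyclic A S) :
    {X : Set V | ∃ v, v ∉ S ∧ X = {s ∈ S | (s, v) ∈ A}}.ncard ≤ S.ncard + 1 := by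
  have hmaps : ∀ X ∈ {X : Set V | ∃ v, v ∉ S ∧ X = {s ∈ S | (s, v) ∈ A}},
      X.ncard ∈ Set.Iio (S.ncard + 1) := by
    rintro X ⟨v, -, rfl⟩
    exact Nat.lt_succ_of_le (Set.ncard_le_ncard (Set.sep_subset _ _) S.toFinite)
  have hinj : Set.InjOn Set.ncard {X : Set V | ∃ v, v ∉ S ∧ X = {s ∈ S | (s, v) ∈ A}} := by
    rintro X ⟨u, hu, rfl⟩ Y ⟨v, hv, rfl⟩ hXY
    rcases hacyc.type_subset_or_subset hT hu hv with h | h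
    · exact Set.eq_of_subset_of_ncard_le h hXY.ge (Set.toFinite _)
    · exact (Set.eq_of_subset_of_ncard_le h hXY.le (Set.toFinite _)).symm
  calc _ ≤ (Set.Iio (S.ncard + 1)).ncard :=
        Set.ncard_le_ncard_of_injOn _ hmaps hinj (Set.finite_Iio _)
    _ = S.ncard + 1 := by simp [Set.ncard_eq_toFinset_card']
end

section
/- Let T be a tournament, S ⊆ V(T), and k a nonnegative integer. If there exists F ⊆ A(T) with |F| ≤ k such that T ⊛ F is S-acyclic, then the number of distinct sets among {Type(v) : v ∈ V(T) \ S} is at most |S| + k + 1. -/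
/-- A chain of subsets of a finite set `S` has at most `|S| + 1` members. -/
theorem ncard_le_of_isChain_subsets {V : Type*} [Finite V] (S : Set V) (C : Set (Set V))
    (hsub : ∀ X ∈ C, X ⊆ S) (hchain : ∀ X ∈ C, ∀ Y ∈ C, X ⊆ Y ∨ Y ⊆ X) :
    C.ncard ≤ S.ncard + 1 := by
  have hmaps : ∀ X ∈ C, X.ncard ∈ Set.Iic S.ncard := fun X hX =>
    Set.ncard_le_ncard (hsub X hX) (Set.toFinite _)
  have hinj : Set.InjOn Set.ncard C := by
    intro X hX Y hY h
    rcases hchain X hX Y hY with hXY | hYX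
    · exact Set.eq_of_subset_of_ncard_le hXY h.ge (Set.toFinite _)
    · exact (Set.eq_of_subset_of_ncard_le hYX h.le (Set.toFinite _)).symm
  have hcard : (Set.Iic S.ncard).ncard = S.ncard + 1 := by
    rw [← Finset.coe_Iic, Set.ncard_coe_finset, Nat.card_Iic]
  exact hcard ▸ Set.ncard_le_ncard_of_injOn Set.ncard hmaps hinj (Set.finite_Iic _)

/-- A closed walk on four distinct vertices, the first in `S`, is an `S`-cycle. -/
theorem hasSCycle_of_four {V : Type*} {B : Set (V × V)} {S : Set V} {a b c d : V} (ha : a ∈ S)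
    (hab : (a, b) ∈ B) (hbc : (b, c) ∈ B) (hcd : (c, d) ∈ B) (hda : (d, a) ∈ B)
    (nab : a ≠ b) (nac : a ≠ c) (nad : a ≠ d) (nbc : b ≠ c) (nbd : b ≠ d) (ncd : c ≠ d) :
    HasSCycle B S := by
  let f : Fin 4 → V := ![a, b, c, d]
  have hf : Function.Injective f := by
    intro i j h
    fin_cases i <;> fin_cases j <;> simp_all [f]
  have harc : ∀ i : Fin 4, (f i, f (i + 1)) ∈ B := by
    intro i
    fin_cases i
    exacts [hab, hbc, hcd, hda]
  exact ⟨4, f, ⟨by norm_num, hf, harc⟩, (0 : Fin 4), ha⟩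

/-- if some `F ⊆ A(T)` with `|F| ≤ k` reversed makes the
tournament `T` `S`-acyclic, then the number of distinct sets
`Type(v) = {s ∈ S : (s,v) ∈ A}` over `v ∈ V(T) \ S` is at most `|S| + k + 1`. -/
theorem stmt_14 {V : Type*} [Fintype V] (A : Set (V × V)) (hT : IsTournament A)
    (S : Set V) (k : ℕ)
    (hsol : ∃ F ⊆ A, F.ncard ≤ k ∧ SAcyclic (revArcs A F) S) :
    {X : Set V | ∃ v, v ∉ S ∧ X = {s ∈ S | (s, v) ∈ A}}.ncard ≤
      S.ncard + k + 1 := by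
  classical
  obtain ⟨F, -, hFk, hac⟩ := hsol
  let type : V → Set V := fun v => {s ∈ S | (s, v) ∈ A}
  let outer : V × V → V := fun p => if p.1 ∈ S then p.2 else p.1
  let D : Set V := outer '' F
  let C : Set (Set V) := type '' {v | v ∉ S ∧ v ∉ D}
  have hD : D.ncard ≤ k := (Set.ncard_image_le (Set.toFinite _)).trans hFk
  have hin : ∀ s ∈ S, ∀ v, v ∉ D → (s, v) ∈ A → (s, v) ∈ revArcs A F :=
    fun s hs v hv h => ⟨Or.inl h, fun hF => hv ⟨_, hF, if_pos hs⟩⟩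
  have hout : ∀ s ∈ S, ∀ v, v ∉ S → v ∉ D → (s, v) ∉ A → (v, s) ∈ revArcs A F := by
    intro s hs v hvS hv h
    have hvs : v ≠ s := fun e => hvS (e ▸ hs)
    exact ⟨Or.inl ((hT.2 v s hvs).2 h), fun hF => hv ⟨_, hF, if_neg hvS⟩⟩
  have hC : C.ncard ≤ S.ncard + 1 := by
    apply ncard_le_of_isChain_subsets
    · rintro _ ⟨v, -, rfl⟩ s hs
      exact hs.1
    · rintro _ ⟨v, ⟨hvS, hvD⟩, rfl⟩ _ ⟨w, ⟨hwS, hwD⟩, rfl⟩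
      by_contra! h
      obtain ⟨s, ⟨hs, hsv⟩, hsw⟩ := Set.not_subset.1 h.1
      obtain ⟨t, ⟨ht, htw⟩, htv⟩ := Set.not_subset.1 h.2
      have hsw' : (s, w) ∉ A := fun e => hsw ⟨hs, e⟩
      have htv' : (t, v) ∉ A := fun e => htv ⟨ht, e⟩
      exact hac (hasSCycle_of_four hs (hin s hs v hvD hsv) (hout t ht v hvS hvD htv')
        (hin t ht w hwD htw) (hout s hs w hwS hwD hsw')
        (fun e => hvS (e ▸ hs)) (fun e => htv' (e ▸ hsv)) (fun e => hwS (e ▸ hs))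
        (fun e => hvS (e ▸ ht)) (fun e => hsw' (e ▸ hsv)) (fun e => hwS (e ▸ ht)))
  have hcover : {X : Set V | ∃ v, v ∉ S ∧ X = {s ∈ S | (s, v) ∈ A}} ⊆ type '' D ∪ C := by
    rintro _ ⟨v, hv, rfl⟩
    by_cases hvD : v ∈ D
    · exact Or.inl ⟨v, hvD, rfl⟩
    · exact Or.inr ⟨v, ⟨hv, hvD⟩, rfl⟩
  have hle := Set.ncard_le_ncard hcover (Set.toFinite _)
  have hunion := Set.ncard_union_le (type '' D) C
  have himage : (type '' D).ncard ≤ D.ncard := Set.ncard_image_le (Set.toFinite _)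
  omega
end

section
/- Let T be a tournament, S ⊆ V(T), and k a nonnegative integer such that no arc of T is contained in more than k distinct S-triangles. Let S₁ ⊆ S, let Z = {v ∈ V(T) \ S : Type(v) = S₁}, and suppose |Z| ≥ 6k + 6. Let Z' be the set of vertices of Z that have at least k+1 in-neighbors in Z and at least k+1 out-neighbors in Z. Then every vertex v ∈ V(T) \ (S ∪ Z) satisfies exactly one of the following: (a) v has at most k in-neighbors in Z' and at least k+1 out-neighbors in Z', or (b) v has at least k+1 in-neighbors in Z' and at most k out-neighbors in Z'. -/
/-- The tournament obtained by reversing all arcs. -/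
theorem IsTournament.swap {V : Type*} {A : Set (V × V)} (hT : IsTournament A) :
    IsTournament (Prod.swap ⁻¹' A) :=
  ⟨fun v => hT.1 v, fun u v huv => hT.2 v u huv.symm⟩

/-- Every vertex outside `X` is joined to each vertex of `X` by exactly one arc. -/
theorem IsTournament.ncard_in_add_ncard_out {V : Type*} [Finite V] {A : Set (V × V)}
    (hT : IsTournament A) {X : Set V} {v : V} (hv : v ∉ X) :
    {u ∈ X | (u, v) ∈ A}.ncard + {u ∈ X | (v, u) ∈ A}.ncard = X.ncard := by
  rw [← Set.ncard_union_eq]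
  · congr 1
    ext u
    have := hT.2 u v
    simp only [Set.mem_union, Set.mem_ofPred_eq]
    constructor
    · tauto
    · intro hu
      have huv : u ≠ v := by rintro rfl; exact hv hu
      tauto
  · rw [Set.disjoint_left]
    rintro u ⟨hu, h₁⟩ ⟨-, h₂⟩
    exact (hT.2 u v (by rintro rfl; exact hv hu)).1 h₁ h₂

/-- A set of vertices whose in-degrees within the set are at most `k` has at most `2k+1`
elements. -/
theorem IsTournament.ncard_le_of_indegree_le {V : Type*} [Finite V] {A : Set (V × V)}
    (hT : IsTournament A) {X : Set V} {k : ℕ}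
    (hX : ∀ v ∈ X, {u ∈ X | (u, v) ∈ A}.ncard ≤ k) : X.ncard ≤ 2 * k + 1 := by
  classical
  have := Fintype.ofFinite V
  have hsum : ∑ v ∈ X.toFinset, {u ∈ X | (v, u) ∈ A}.ncard =
      ∑ v ∈ X.toFinset, {u ∈ X | (u, v) ∈ A}.ncard := by
    have h := Finset.sum_card_bipartiteAbove_eq_sum_card_bipartiteBelow
      (s := X.toFinset) (t := X.toFinset) (fun u v => (u, v) ∈ A)
    convert h using 2 <;>
    · rw [Set.ncard_eq_toFinset_card']
      congr 1
      ext u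
      simp [Finset.bipartiteAbove, Finset.bipartiteBelow]
  have hdeg : ∀ v ∈ X.toFinset,
      {u ∈ X | (u, v) ∈ A}.ncard + {u ∈ X | (v, u) ∈ A}.ncard + 1 = X.ncard := by
    intro v hv
    rw [Set.mem_toFinset] at hv
    have h := hT.ncard_in_add_ncard_out (X := X \ {v}) (v := v) (by simp)
    have h₁ : {u ∈ X \ {v} | (u, v) ∈ A} = {u ∈ X | (u, v) ∈ A} := by
      ext u
      have := hT.1 v
      simp only [Set.mem_ofPred_eq, Set.mem_sdiff, Set.mem_singleton_iff]
      grind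
    have h₂ : {u ∈ X \ {v} | (v, u) ∈ A} = {u ∈ X | (v, u) ∈ A} := by
      ext u
      have := hT.1 v
      simp only [Set.mem_ofPred_eq, Set.mem_sdiff, Set.mem_singleton_iff]
      grind
    rw [h₁, h₂] at h
    rw [h, Set.ncard_sdiff_singleton_add_one hv]
  have htotal := Finset.sum_congr rfl hdeg
  rw [Finset.sum_add_distrib, Finset.sum_add_distrib, hsum] at htotal
  have hle : ∑ v ∈ X.toFinset, {u ∈ X | (u, v) ∈ A}.ncard ≤ X.toFinset.card * k := by
    simpa using Finset.sum_le_card_nsmul _ _ k fun v hv => hX v (Set.mem_toFinset.1 hv)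
  have hcard : X.toFinset.card = X.ncard := (Set.ncard_eq_toFinset_card' X).symm
  simp only [Finset.sum_const, smul_eq_mul, mul_one, hcard] at htotal hle
  by_contra! hlt
  nlinarith

/-- At most `2k+1` vertices of `Z` have in-degree at most `k` within `Z`. -/
theorem IsTournament.ncard_small_indegree_le {V : Type*} [Finite V] {A : Set (V × V)}
    (hT : IsTournament A) (Z : Set V) (k : ℕ) :
    {v ∈ Z | {u ∈ Z | (u, v) ∈ A}.ncard ≤ k}.ncard ≤ 2 * k + 1 :=
  hT.ncard_le_of_indegree_le fun _ hv =>
    (Set.ncard_le_ncard (t := {u ∈ Z | (u, _) ∈ A}) fun _ hu => ⟨hu.1.1, hu.2⟩).trans hv.2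

/-- suppose no arc of the tournament `T` is contained in more
than `k` distinct `S`-triangles, `Z = {v ∉ S : Type(v) = S₁}` with
`|Z| ≥ 6k + 6`, and `Z'` is the set of vertices of `Z` with at least `k+1`
in-neighbors and at least `k+1` out-neighbors inside `Z`. Then every vertex
outside `S ∪ Z` either has at most `k` in-neighbors and at least `k+1`
out-neighbors in `Z'`, or at least `k+1` in-neighbors and at most `k`
out-neighbors in `Z'` — and exactly one of the two. -/
theorem stmt_17 {V : Type*} [Fintype V] (A : Set (V × V)) (hT : IsTournament A)
    (S : Set V) (k : ℕ)
    (hfew : ∀ u v : V, (u, v) ∈ A → {w | IsSTriThrough A S u v w}.ncard ≤ k)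
    (S₁ : Set V) (hS₁ : S₁ ⊆ S) (Z Z' : Set V)
    (hZ : Z = {v | v ∉ S ∧ {s ∈ S | (s, v) ∈ A} = S₁})
    (hZbig : 6 * k + 6 ≤ Z.ncard)
    (hZ' : Z' = {v ∈ Z | k + 1 ≤ {u ∈ Z | (u, v) ∈ A}.ncard ∧
      k + 1 ≤ {u ∈ Z | (v, u) ∈ A}.ncard}) :
    ∀ v : V, v ∉ S → v ∉ Z →
      Xor'
        ({u ∈ Z' | (u, v) ∈ A}.ncard ≤ k ∧
          k + 1 ≤ {u ∈ Z' | (v, u) ∈ A}.ncard)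
        (k + 1 ≤ {u ∈ Z' | (u, v) ∈ A}.ncard ∧
          {u ∈ Z' | (v, u) ∈ A}.ncard ≤ k) := by
  intro v hvS hvZ
  have hsub : Z' ⊆ Z := by rw [hZ']; exact Set.sep_subset _ _
  have hlarge : 2 * k + 1 ≤ Z'.ncard := by
    have hin := hT.ncard_small_indegree_le Z k
    have hout := hT.swap.ncard_small_indegree_le Z k
    have hcover : Z ⊆ Z' ∪ {v ∈ Z | {u ∈ Z | (u, v) ∈ A}.ncard ≤ k} ∪
        {v ∈ Z | {u ∈ Z | (u, v) ∈ Prod.swap ⁻¹' A}.ncard ≤ k} := by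
      intro z hz
      simp only [hZ', Set.mem_union, Set.mem_ofPred_eq, Set.mem_preimage, Prod.swap_prod_mk, hz,
        true_and]
      omega
    have h₁ := Set.ncard_le_ncard hcover
    have h₂ := Set.ncard_union_le (Z' ∪ {v ∈ Z | {u ∈ Z | (u, v) ∈ A}.ncard ≤ k})
      {v ∈ Z | {u ∈ Z | (u, v) ∈ Prod.swap ⁻¹' A}.ncard ≤ k}
    have h₃ := Set.ncard_union_le Z' {v ∈ Z | {u ∈ Z | (u, v) ∈ A}.ncard ≤ k}
    omega
  have hsplit := hT.ncard_in_add_ncard_out fun h => hvZ (hsub h)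
  have hZmem : ∀ z ∈ Z', z ∉ S ∧ ∀ s ∈ S, (s, z) ∈ A ↔ s ∈ S₁ := by
    intro z hz
    have h := hsub hz
    rw [hZ] at h
    refine ⟨h.1, fun s hs => ?_⟩
    rw [← h.2]
    exact ⟨fun h => ⟨hs, h⟩, fun h => h.2⟩
  obtain ⟨s, hs⟩ : ∃ s, ¬ (s ∈ {s ∈ S | (s, v) ∈ A} ↔ s ∈ S₁) := by
    by_contra! h
    exact hvZ (hZ ▸ ⟨hvS, Set.ext h⟩)
  have hfewer : {u ∈ Z' | (u, v) ∈ A}.ncard ≤ k ∨ {u ∈ Z' | (v, u) ∈ A}.ncard ≤ k := by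
    by_cases hs₁ : s ∈ S₁
    · have hsS := hS₁ hs₁
      have hvs : (v, s) ∈ A := by
        rw [hT.2 v s (by rintro rfl; exact hvS hsS)]
        exact fun h => hs ⟨fun _ => hs₁, fun _ => ⟨hsS, h⟩⟩
      exact Or.inl <| (Set.ncard_le_ncard (t := {w | IsSTriThrough A S v s w}) fun z hz =>
        ⟨hvs, ((hZmem z hz.1).2 s hsS).2 hs₁, hz.2, Or.inr (Or.inl hsS)⟩).trans (hfew v s hvs)
    · obtain ⟨hsS, hsv⟩ : s ∈ S ∧ (s, v) ∈ A := by
        by_contra h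
        exact hs ⟨fun h' => absurd h' h, fun h' => absurd h' hs₁⟩
      refine Or.inr <| (Set.ncard_le_ncard (t := {w | IsSTriThrough A S s v w}) fun z hz =>
        ⟨hsv, hz.2, ?_, Or.inl hsS⟩).trans (hfew s v hsv)
      obtain ⟨hzS, hz⟩ := hZmem z hz.1
      rw [hT.2 z s (by rintro rfl; exact hzS hsS), hz s hsS]
      exact hs₁
  rcases hfewer with h | h
  · exact Or.inl (by omega)
  · exact Or.inr (by omega)
end

section
/- Let G be a finite graph with vertex set V of size n and with m ≥ 1 edges, and let q = ⌈√(8m)⌉. If each vertex of G is assigned a color from {1, …, q} independently and uniformly at random, then the probability that no edge of G is monochromatic is at least (2e)^(−√(m/8)). Equivalently, the number of functions f : V → {1, …, q} under which no edge of G has both endpoints with the same value is at least q^n · (2e)^(−√(m/8)). -/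
open Classical in
/-- The finset of proper colorings of `G` with colors in `Fin q`. -/
noncomputable def properColorings {V : Type*} [Fintype V] (G : SimpleGraph V) (q : ℕ) :
    Finset (V → Fin q) :=
  Finset.univ.filter fun f => ∀ u v : V, G.Adj u v → f u ≠ f v

lemma mem_properColorings {V : Type*} [Fintype V] {G : SimpleGraph V} {q : ℕ} {f : V → Fin q} :
    f ∈ properColorings G q ↔ ∀ u v : V, G.Adj u v → f u ≠ f v := by
  simp [properColorings]

open Classical in
lemma card_properColorings_deleteIncidenceSet_mul_le {V : Type*} [Fintype V] (G : SimpleGraph V)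
    (q : ℕ) (v : V) :
    (properColorings (G.deleteIncidenceSet v) q).card * (q - G.degree v) ≤
      (properColorings G q).card * q := by
  let A : (V → Fin q) → Finset (Fin q) := fun f => Finset.univ \ (G.neighborFinset v).image f
  have hA (f : V → Fin q) : q - G.degree v ≤ (A f).card := by
    have h := Finset.le_card_sdiff ((G.neighborFinset v).image f) Finset.univ
    have h' : ((G.neighborFinset v).image f).card ≤ G.degree v := Finset.card_image_le
    simp only [Finset.card_univ, Fintype.card_fin] at h
    exact le_trans (by omega) h
  calc
    _ ≤ ∑ f ∈ properColorings (G.deleteIncidenceSet v) q, (A f).card := by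
      rw [← smul_eq_mul]
      exact Finset.card_nsmul_le_sum _ _ _ fun f _ => hA f
    _ = ((properColorings (G.deleteIncidenceSet v) q).sigma A).card :=
      (Finset.card_sigma _ _).symm
    _ ≤ (properColorings G q ×ˢ (Finset.univ : Finset (Fin q))).card := by
      refine Finset.card_le_card_of_injOn (fun p => (Function.update p.1 v p.2, p.1 v)) ?_ ?_
      · rintro ⟨f, c⟩ h
        simp only [Finset.coe_sigma, Set.mem_sigma_iff, Finset.mem_coe, mem_properColorings,
          SimpleGraph.deleteIncidenceSet_adj, A, Finset.mem_sdiff, Finset.mem_univ, true_and,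
          Finset.mem_image, SimpleGraph.mem_neighborFinset, not_exists, not_and] at h
        obtain ⟨hf, hc⟩ := h
        simp only [Finset.coe_product, Set.mem_prod, Finset.mem_coe, mem_properColorings,
          Finset.mem_univ, and_true]
        intro a b hab
        by_cases ha : a = v
        · subst ha
          rw [Function.update_self, Function.update_of_ne hab.ne']
          exact fun h => hc b hab h.symm
        · by_cases hb : b = v
          · subst hb
            rw [Function.update_self, Function.update_of_ne ha]
            exact hc a hab.symm
          · rw [Function.update_of_ne ha, Function.update_of_ne hb]
            exact hf a b ⟨hab, ha, hb⟩
      · rintro ⟨f, c⟩ - ⟨g, d⟩ - h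
        simp only [Prod.mk.injEq] at h
        obtain ⟨h, hv⟩ := h
        have hcd : c = d := by simpa using congrFun h v
        have hfg : f = g := by
          funext w
          by_cases hw : w = v
          · rw [hw, hv]
          · simpa [hw] using congrFun h w
        rw [hfg, hcd]
    _ = _ := by simp

/-- A vertex of minimal positive degree has degree at most `√(2m)`. -/
lemma exists_degree_pos_sq_le {V : Type*} [Fintype V] (G : SimpleGraph V) [DecidableRel G.Adj]
    (h : G.edgeFinset.Nonempty) :
    ∃ v, 0 < G.degree v ∧ G.degree v ^ 2 ≤ 2 * G.edgeFinset.card := by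
  have hne : (Finset.univ.filter fun v => 0 < G.degree v).Nonempty := by
    obtain ⟨e, he⟩ := h
    induction e with
    | h a b =>
      refine ⟨a, ?_⟩
      simp only [Finset.mem_filter, Finset.mem_univ, true_and]
      exact (G.degree_pos_iff_exists_adj a).2 ⟨b, by simpa using he⟩
  obtain ⟨v, hv, hmin⟩ := Finset.exists_min_image _ (fun v => G.degree v) hne
  simp only [Finset.mem_filter, Finset.mem_univ, true_and] at hv hmin
  refine ⟨v, hv, ?_⟩
  calc
    G.degree v ^ 2 = (G.neighborFinset v).card • G.degree v := by
      rw [SimpleGraph.card_neighborFinset_eq_degree, smul_eq_mul, sq]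
    _ ≤ ∑ w ∈ G.neighborFinset v, G.degree w := by
      refine Finset.card_nsmul_le_sum _ _ _ fun w hw => hmin w ?_
      exact (G.degree_pos_iff_exists_adj w).2 ⟨v, by simpa [G.adj_comm] using hw⟩
    _ ≤ ∑ w, G.degree w := Finset.sum_le_sum_of_subset (Finset.subset_univ _)
    _ = _ := G.sum_degrees_eq_twice_card_edges

open Classical in
lemma pow_mul_half_rpow_le_card_properColorings {V : Type*} [Fintype V] (G : SimpleGraph V)
    (q : ℕ) (hq0 : 0 < q) (hq : 8 * G.edgeFinset.card ≤ q ^ 2) :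
    (q : ℝ) ^ Fintype.card V * (1 / 2 : ℝ) ^ (2 * (G.edgeFinset.card : ℝ) / q) ≤
      (properColorings G q).card := by
  induction hm : G.edgeFinset.card using Nat.strong_induction_on generalizing G with
  | _ m ih =>
  rcases G.edgeFinset.eq_empty_or_nonempty with h | h
  · have hG : G = ⊥ := by simpa using h
    have hm0 : m = 0 := by rw [← hm, h, Finset.card_empty]
    have hall : properColorings G q = Finset.univ := by
      ext f
      simp [mem_properColorings, hG]
    simp [hall, hm0]
  · obtain ⟨v, hv, hd⟩ := exists_degree_pos_sq_le G h
    have hcard := G.card_edgeFinset_deleteIncidenceSet v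
    have hdm : G.degree v ≤ G.edgeFinset.card := by
      rw [← G.card_incidenceFinset_eq_degree v]
      exact Finset.card_le_card (G.incidenceFinset_subset v)
    have hdq : 2 * G.degree v ≤ q := by nlinarith
    have hstep := card_properColorings_deleteIncidenceSet_mul_le G q v
    have hle : 8 * (G.deleteIncidenceSet v).edgeFinset.card ≤ q ^ 2 := by omega
    have hind := ih (m - G.degree v) (by omega) (G.deleteIncidenceSet v)
      (by convert hle)
      (by rw [← hm, ← hcard]; congr!)
    set d := G.degree v
    rw [Nat.cast_sub (by omega)] at hind
    have hqpos : (0 : ℝ) < q := by exact_mod_cast hq0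
    have hdq' : 2 * (d : ℝ) ≤ q := by exact_mod_cast hdq
    have hb : (1 / 2 : ℝ) ^ (2 * (d : ℝ) / q) ≤ (q - d) / q := by
      have := rpow_one_add_le_one_add_mul_self (s := -1 / 2) (by norm_num)
        (p := 2 * (d : ℝ) / q) (by positivity) ((div_le_one hqpos).2 hdq')
      convert this using 1
      · norm_num
      · field_simp
        ring
    have hstep' : ((properColorings (G.deleteIncidenceSet v) q).card : ℝ) * (q - d) ≤
        (properColorings G q).card * q := by
      rw [← Nat.cast_sub (by omega)]
      exact_mod_cast hstep
    calc
      _ = ((q : ℝ) ^ Fintype.card V * (1 / 2 : ℝ) ^ (2 * ((m : ℝ) - d) / q)) *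
          (1 / 2 : ℝ) ^ (2 * (d : ℝ) / q) := by
        rw [mul_assoc, ← Real.rpow_add (by norm_num)]
        congr 2
        ring
      _ ≤ (properColorings (G.deleteIncidenceSet v) q).card * ((q - d) / q) := by gcongr
      _ ≤ _ := by
        rw [← mul_div_assoc]
        exact (div_le_iff₀ hqpos).2 hstep'

/-- let `G` be a finite simple graph with `n` vertices and
`m ≥ 1` edges and let `q = ⌈√(8m)⌉`. The number of colorings `f : V → {1,…,q}`
under which no edge of `G` is monochromatic is at least
`q^n · (2e)^(−√(m/8))`; equivalently, a uniformly random coloring is proper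
with probability at least `(2e)^(−√(m/8))`. -/
theorem stmt_19 {V : Type*} [Fintype V] [DecidableEq V] (G : SimpleGraph V)
    (m : ℕ) (hm : m = G.edgeSet.ncard) (hm1 : 1 ≤ m)
    (q : ℕ) (hq : q = ⌈Real.sqrt (8 * m)⌉₊) :
    (q : ℝ) ^ (Fintype.card V) * (2 * Real.exp 1) ^ (-Real.sqrt ((m : ℝ) / 8))
      ≤ Nat.card {f : V → Fin q // ∀ u v : V, G.Adj u v → f u ≠ f v} := by
  classical
  have hmcard : G.edgeFinset.card = m := by
    rw [hm, ← SimpleGraph.coe_edgeFinset, Set.ncard_coe_finset]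
  have hm0 : (1 : ℝ) ≤ m := by exact_mod_cast hm1
  have hsq : Real.sqrt (8 * m) ≤ q := hq ▸ Nat.le_ceil _
  have hqpos : (0 : ℝ) < q := lt_of_lt_of_le (Real.sqrt_pos.2 (by linarith)) hsq
  have h8 : 8 * G.edgeFinset.card ≤ q ^ 2 := by
    rw [hmcard]
    exact_mod_cast (Real.sqrt_le_left hqpos.le).1 hsq
  have hcount : Nat.card {f : V → Fin q // ∀ u v : V, G.Adj u v → f u ≠ f v} =
      (properColorings G q).card := by
    rw [Nat.card_eq_fintype_card]
    exact Fintype.card_of_subtype _ fun f => mem_properColorings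
  rw [hcount]
  refine le_trans ?_ (pow_mul_half_rpow_le_card_properColorings G q (by exact_mod_cast hqpos) h8)
  rw [hmcard]
  gcongr
  have hexp : 2 * (m : ℝ) / q ≤ 2 * Real.sqrt ((m : ℝ) / 8) := by
    rw [div_le_iff₀ hqpos]
    have hmul : Real.sqrt ((m : ℝ) / 8) * Real.sqrt (8 * m) = m := by
      rw [← Real.sqrt_mul (by positivity), show (m : ℝ) / 8 * (8 * m) = m * m by ring,
        Real.sqrt_mul_self (by positivity)]
    nlinarith [Real.sqrt_nonneg ((m : ℝ) / 8)]
  have he : (2 : ℝ) ≤ Real.exp 1 := by linarith [Real.add_one_le_exp (1 : ℝ)]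
  calc
    (2 * Real.exp 1) ^ (-Real.sqrt ((m : ℝ) / 8)) ≤ (4 : ℝ) ^ (-Real.sqrt ((m : ℝ) / 8)) :=
      Real.rpow_le_rpow_of_nonpos (by norm_num) (by linarith)
        (neg_nonpos.2 (Real.sqrt_nonneg _))
    _ = (1 / 2 : ℝ) ^ (2 * Real.sqrt ((m : ℝ) / 8)) := by
      rw [Real.rpow_mul (by norm_num), Real.rpow_neg (by norm_num), ← Real.inv_rpow (by norm_num)]
      norm_num
    _ ≤ (1 / 2 : ℝ) ^ (2 * (m : ℝ) / q) :=
      Real.rpow_le_rpow_of_exponent_ge (by norm_num) (by norm_num) hexp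
end
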